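/- arXiv:1709.05532 — 2 statements merged into one kernel-verified Lean document; each statement's English description precedes it below -/
import Mathlib

section
/- The E8 lattice contains exactly 2160 vectors of norm 4. -/
/-- The `E₈` lattice: vectors in `ℚ⁸` whose coordinates are all integers or all
half-odd-integers, with coordinate sum an even integer. -/
def E8 : Set (Fin 8 → ℚ) :=
  {v | ((∀ i, ∃ n : ℤ, v i = n) ∨ (∀ i, ∃ n : ℤ, v i = n + 1/2)) ∧
    ∃ m : ℤ, (∑ i, v i) = 2 * m}

/-- The standard inner product on `ℚ⁸`. -/
def ip (v w : Fin 8 → ℚ) : ℚ := ∑ i, v i * w i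

/-- The vectors of length `n` with entries in `[-2, 2]`, total weight `s` and coordinate sum of the
same parity as `p`. -/
noncomputable def weightedVectors (w : ℤ → ℤ) (n : ℕ) (s p : ℤ) : Finset (Fin n → ℤ) :=
  {f ∈ Fintype.piFinset fun _ => Finset.Icc (-2) 2 | ∑ i, w (f i) = s ∧ (p + ∑ i, f i) % 2 = 0}

/-- A recursive evaluation of the cardinality of `weightedVectors`. -/
def weightedCount (w : ℤ → ℤ) : ℕ → ℤ → ℤ → ℕ
  | 0, s, p => if s = 0 ∧ p % 2 = 0 then 1 else 0
  | n + 1, s, p =>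
    ([-2, -1, 0, 1, 2].map fun x =>
      if w x ≤ s then weightedCount w n (s - w x) (p + x) else 0).sum

theorem mem_weightedVectors {w : ℤ → ℤ} {n : ℕ} {s p : ℤ} {f : Fin n → ℤ} :
    f ∈ weightedVectors w n s p ↔
      (∀ i, -2 ≤ f i ∧ f i ≤ 2) ∧ ∑ i, w (f i) = s ∧ (p + ∑ i, f i) % 2 = 0 := by
  simp [weightedVectors, Fintype.mem_piFinset]

theorem weightedVectors_eq_empty {w : ℤ → ℤ} (hw : ∀ x, 0 ≤ w x) (n : ℕ) {s : ℤ} (hs : s < 0)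
    (p : ℤ) : weightedVectors w n s p = ∅ := by
  refine Finset.eq_empty_of_forall_notMem fun f hf => ?_
  have h := (mem_weightedVectors.1 hf).2.1
  have := Finset.sum_nonneg fun i (_ : i ∈ Finset.univ) => hw (f i)
  omega

theorem card_weightedVectors_succ (w : ℤ → ℤ) (n : ℕ) (s p : ℤ) :
    (weightedVectors w (n + 1) s p).card =
      ∑ x ∈ Finset.Icc (-2) 2, (weightedVectors w n (s - w x) (p + x)).card := by
  rw [← Finset.card_sigma]
  refine Finset.card_nbij' (fun f => ⟨f 0, Fin.tail f⟩) (fun y => Fin.cons y.1 y.2) ?_ ?_ ?_ ?_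
  · intro f hf
    simp only [Finset.mem_coe, mem_weightedVectors, Fin.forall_fin_succ, Fin.sum_univ_succ,
      Finset.mem_sigma, Finset.mem_Icc, Fin.tail] at hf ⊢
    exact ⟨hf.1.1, hf.1.2, by omega, by omega⟩
  · rintro ⟨x, f⟩ hf
    simp only [Finset.mem_coe, mem_weightedVectors, Fin.forall_fin_succ, Fin.sum_univ_succ,
      Finset.mem_sigma, Finset.mem_Icc, Fin.cons_zero, Fin.cons_succ] at hf ⊢
    exact ⟨⟨hf.1, hf.2.1⟩, by omega, by omega⟩
  · intro f _
    exact Fin.cons_self_tail f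
  · rintro ⟨x, f⟩ _
    simp

theorem card_weightedVectors {w : ℤ → ℤ} (hw : ∀ x, 0 ≤ w x) (n : ℕ) (s p : ℤ) :
    (weightedVectors w n s p).card = weightedCount w n s p := by
  induction n generalizing s p with
  | zero =>
    simp only [weightedVectors, weightedCount, Finset.univ_eq_empty, Finset.sum_empty, add_zero,
      eq_comm (a := (0 : ℤ)) (b := s)]
    split_ifs with h <;> simp_all
  | succ n ih =>
    have hcard (x : ℤ) : (weightedVectors w n (s - w x) (p + x)).card =
        if w x ≤ s then weightedCount w n (s - w x) (p + x) else 0 := by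
      split_ifs with h
      · exact ih _ _
      · rw [weightedVectors_eq_empty hw n (by omega), Finset.card_empty]
    rw [card_weightedVectors_succ, weightedCount, Finset.sum_congr rfl fun x _ => hcard x]
    rfl

theorem card_weightedVectors_sq : (weightedVectors (fun x => x * x) 8 4 0).card = 1136 := by
  rw [card_weightedVectors mul_self_nonneg]
  decide +kernel

theorem mul_self_add_self_nonneg (x : ℤ) : 0 ≤ x * x + x := by
  rcases le_or_gt 0 x with h | h <;> nlinarith

theorem card_weightedVectors_sq_add_self :
    (weightedVectors (fun x => x * x + x) 8 2 0).card = 1024 := by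
  rw [card_weightedVectors mul_self_add_self_nonneg]
  decide +kernel

theorem integral_norm_four_iff (f : Fin 8 → ℤ) :
    ((∃ m : ℤ, ∑ i, (f i : ℚ) = 2 * m) ∧ ip (fun i => f i) (fun i => f i) = 4) ↔
      f ∈ weightedVectors (fun x => x * x) 8 4 0 := by
  rw [ip]
  norm_cast
  rw [mem_weightedVectors]
  constructor
  · rintro ⟨⟨m, hm⟩, h⟩
    refine ⟨fun i => ?_, h, by omega⟩
    have := Finset.single_le_sum (fun j _ => mul_self_nonneg (f j)) (Finset.mem_univ i)
    constructor <;> nlinarith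
  · rintro ⟨-, h, hm⟩
    exact ⟨⟨(∑ i, f i) / 2, by omega⟩, h⟩

theorem half_integral_norm_four_iff (f : Fin 8 → ℤ) :
    ((∃ m : ℤ, ∑ i, (f i + 1 / 2 : ℚ) = 2 * m) ∧
      ip (fun i => f i + 1 / 2) (fun i => f i + 1 / 2) = 4) ↔
      f ∈ weightedVectors (fun x => x * x + x) 8 2 0 := by
  have hsum : ∑ i, (f i + 1 / 2 : ℚ) = (∑ i, f i + 4 : ℤ) := by
    rw [Finset.sum_add_distrib]
    norm_num
  have hip : ip (fun i => f i + 1 / 2) (fun i => f i + 1 / 2) =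
      (∑ i, (f i * f i + f i) + 2 : ℤ) := by
    have (i : Fin 8) : (f i + 1 / 2 : ℚ) * (f i + 1 / 2) = (f i * f i + f i) + 1 / 4 := by ring
    simp only [ip, this]
    rw [Finset.sum_add_distrib]
    norm_num
  rw [hsum, hip]
  norm_cast
  rw [mem_weightedVectors]
  constructor
  · rintro ⟨⟨m, hm⟩, h⟩
    refine ⟨fun i => ?_, by omega, by omega⟩
    have := Finset.single_le_sum (fun j _ => mul_self_add_self_nonneg (f j)) (Finset.mem_univ i)
    constructor <;> nlinarith
  · rintro ⟨-, h, hm⟩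
    exact ⟨⟨(∑ i, f i + 4) / 2, by omega⟩, by omega⟩

theorem setOf_norm_four_eq :
    {v : Fin 8 → ℚ | v ∈ E8 ∧ ip v v = 4} =
      (fun (f : Fin 8 → ℤ) i => (f i : ℚ)) '' weightedVectors (fun x => x * x) 8 4 0 ∪
      (fun (f : Fin 8 → ℤ) i => (f i + 1 / 2 : ℚ)) ''
        weightedVectors (fun x => x * x + x) 8 2 0 := by
  ext v
  simp only [E8, Set.mem_ofPred_eq, Set.mem_union, Set.mem_image, Finset.mem_coe,
    ← integral_norm_four_iff, ← half_integral_norm_four_iff]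
  constructor
  · rintro ⟨⟨h | h, hm⟩, hv⟩
    · choose f hf using h
      obtain rfl := funext hf
      exact Or.inl ⟨f, ⟨hm, hv⟩, rfl⟩
    · choose f hf using h
      obtain rfl := funext hf
      exact Or.inr ⟨f, ⟨hm, hv⟩, rfl⟩
  · rintro (⟨f, ⟨hm, hv⟩, rfl⟩ | ⟨f, ⟨hm, hv⟩, rfl⟩)
    · exact ⟨⟨Or.inl fun i => ⟨f i, rfl⟩, hm⟩, hv⟩
    · exact ⟨⟨Or.inr fun i => ⟨f i, rfl⟩, hm⟩, hv⟩

theorem intCast_ne_intCast_add_half (a b : ℤ) : (a : ℚ) ≠ b + 1 / 2 := by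
  intro h
  have h2 : (2 * a : ℚ) = 2 * b + 1 := by linarith
  norm_cast at h2
  omega

/-- The `E₈` lattice contains exactly 2160 vectors of norm 4. -/
theorem stmt6 : {v : Fin 8 → ℚ | v ∈ E8 ∧ ip v v = 4}.ncard = 2160 := by
  rw [setOf_norm_four_eq, Set.ncard_union_eq, Set.ncard_image_of_injective,
    Set.ncard_image_of_injective, Set.ncard_coe_finset, Set.ncard_coe_finset,
    card_weightedVectors_sq, card_weightedVectors_sq_add_self]
  · intro f g h
    funext i
    simpa using congrFun h i
  · intro f g h
    funext i
    simpa using congrFun h i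
  · rw [Set.disjoint_left]
    rintro _ ⟨f, -, rfl⟩ ⟨g, -, h⟩
    exact intCast_ne_intCast_add_half _ _ (congrFun h 0).symm
end

section
/- Every nonzero isotropic point of E8/2E8 is the image of exactly 16 norm-4 vectors of E8 (namely ±8 pairs), and every nonzero anisotropic point is the image of exactly 2 norm-2 vectors. -/
lemma ip_eq_dotProduct (v w : Fin 8 → ℚ) : ip v w = v ⬝ᵥ w := rfl

lemma mem_E8_of_int {v : Fin 8 → ℚ} (n : Fin 8 → ℤ) (hn : ∀ i, v i = n i)
    (hs : Even (∑ i, n i)) : v ∈ E8 := by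
  obtain ⟨m, hm⟩ := hs
  refine ⟨Or.inl fun i => ⟨n i, hn i⟩, m, ?_⟩
  simp only [hn]
  rw [← Int.cast_sum, hm]
  push_cast
  ring

lemma E8_neg {v : Fin 8 → ℚ} (hv : v ∈ E8) : -v ∈ E8 := by
  obtain ⟨h, m, hm⟩ := hv
  refine ⟨?_, -m, by simp [hm]⟩
  rcases h with h | h
  · refine Or.inl fun i => ?_
    obtain ⟨n, hn⟩ := h i
    exact ⟨-n, by simp [hn]⟩
  · refine Or.inr fun i => ?_
    obtain ⟨n, hn⟩ := h i
    exact ⟨-n - 1, by simp [hn]; ring⟩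

lemma E8_add {v w : Fin 8 → ℚ} (hv : v ∈ E8) (hw : w ∈ E8) : v + w ∈ E8 := by
  obtain ⟨h, m, hm⟩ := hv
  obtain ⟨h', m', hm'⟩ := hw
  refine ⟨?_, m + m', by simp [Finset.sum_add_distrib, hm, hm']; ring⟩
  rcases h with h | h <;> rcases h' with h' | h'
  · refine Or.inl fun i => ?_
    obtain ⟨n, hn⟩ := h i
    obtain ⟨n', hn'⟩ := h' i
    exact ⟨n + n', by simp [hn, hn']⟩
  · refine Or.inr fun i => ?_
    obtain ⟨n, hn⟩ := h i
    obtain ⟨n', hn'⟩ := h' i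
    exact ⟨n + n', by simp [hn, hn']; ring⟩
  · refine Or.inr fun i => ?_
    obtain ⟨n, hn⟩ := h i
    obtain ⟨n', hn'⟩ := h' i
    exact ⟨n + n', by simp [hn, hn']; ring⟩
  · refine Or.inl fun i => ?_
    obtain ⟨n, hn⟩ := h i
    obtain ⟨n', hn'⟩ := h' i
    exact ⟨n + n' + 1, by simp [hn, hn']; ring⟩

lemma E8_two_smul {v : Fin 8 → ℚ} (hv : v ∈ E8) : (2 : ℚ) • v ∈ E8 := by
  rw [two_smul]
  exact E8_add hv hv

lemma E8_norm_even {v : Fin 8 → ℚ} (hv : v ∈ E8) : ∃ m : ℤ, ip v v = 2 * m := by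
  obtain ⟨h | h, m, hm⟩ := hv
  · choose n hn using h
    simp only [hn] at hm
    have hpar : ∀ i, ∃ c : ℤ, n i * n i = n i + 2 * c := fun i => by
      obtain ⟨c, hc⟩ := Int.even_mul_pred_self (n i)
      exact ⟨c, by linarith⟩
    choose c hc using hpar
    refine ⟨m + ∑ i, c i, ?_⟩
    have : ∀ i, v i * v i = n i + 2 * c i := fun i => by
      rw [hn i]
      exact_mod_cast hc i
    simp only [ip, this, Finset.sum_add_distrib, hm, ← Finset.mul_sum]
    push_cast
    ring
  · choose n hn using h
    have hpar : ∀ i, ∃ c : ℤ, n i * (n i + 1) = 2 * c := fun i => by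
      obtain ⟨c, hc⟩ := Int.even_mul_succ_self (n i)
      exact ⟨c, by linarith⟩
    choose c hc using hpar
    refine ⟨1 + ∑ i, c i, ?_⟩
    have : ∀ i, v i * v i = 2 * c i + 1 / 4 := fun i => by
      have := hc i
      rw [hn i]
      have : (n i : ℚ) * (n i + 1) = 2 * c i := by exact_mod_cast this
      linarith
    simp only [ip, this, Finset.sum_add_distrib, ← Finset.mul_sum]
    simp
    ring

lemma ip_add_self (v w : Fin 8 → ℚ) : ip (v + w) (v + w) = ip v v + 2 * ip v w + ip w w := by
  simp only [ip_eq_dotProduct, add_dotProduct, dotProduct_add, dotProduct_comm w v]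
  ring

lemma ip_sub_self (v w : Fin 8 → ℚ) : ip (v - w) (v - w) = ip v v - 2 * ip v w + ip w w := by
  simp only [ip_eq_dotProduct, sub_dotProduct, dotProduct_sub, dotProduct_comm w v]
  ring

lemma ip_neg_self (v : Fin 8 → ℚ) : ip (-v) (-v) = ip v v := by
  simp [ip]

lemma ip_two_smul_self (v : Fin 8 → ℚ) : ip ((2 : ℚ) • v) ((2 : ℚ) • v) = 4 * ip v v := by
  simp only [ip_eq_dotProduct, smul_dotProduct, dotProduct_smul, smul_eq_mul]
  ring

lemma E8_ip_int {v w : Fin 8 → ℚ} (hv : v ∈ E8) (hw : w ∈ E8) : ∃ m : ℤ, ip v w = m := by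
  obtain ⟨a, ha⟩ := E8_norm_even hv
  obtain ⟨b, hb⟩ := E8_norm_even hw
  obtain ⟨c, hc⟩ := E8_norm_even (E8_add hv hw)
  refine ⟨c - a - b, ?_⟩
  rw [ip_add_self] at hc
  push_cast
  linarith

lemma E8_norm_ge_two {v : Fin 8 → ℚ} (hv : v ∈ E8) (h0 : v ≠ 0) : 2 ≤ ip v v := by
  have hne : ip v v ≠ 0 := fun h => h0 (dotProduct_self_eq_zero.mp h)
  have hnn : 0 ≤ ip v v := Finset.sum_nonneg fun i _ => mul_self_nonneg (v i)
  obtain ⟨m, hm⟩ := E8_norm_even hv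
  have hpos : (0 : ℚ) < 2 * m := hm ▸ lt_of_le_of_ne hnn hne.symm
  have : (0 : ℚ) < m := by linarith
  have : (1 : ℚ) ≤ m := by exact_mod_cast (show (0 : ℤ) < m by exact_mod_cast this)
  linarith

/-- Congruence modulo `2Λ`. -/
def CongTwoE8 (w v : Fin 8 → ℚ) : Prop := ∃ u ∈ E8, w - v = (2 : ℚ) • u

namespace CongTwoE8

variable {u v w : Fin 8 → ℚ}

lemma symm (h : CongTwoE8 w v) : CongTwoE8 v w := by
  obtain ⟨x, hx, e⟩ := h
  exact ⟨-x, E8_neg hx, by rw [smul_neg, ← e, neg_sub]⟩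

lemma trans (h : CongTwoE8 u v) (h' : CongTwoE8 v w) : CongTwoE8 u w := by
  obtain ⟨x, hx, e⟩ := h
  obtain ⟨y, hy, e'⟩ := h'
  exact ⟨x + y, E8_add hx hy, by rw [smul_add, ← e, ← e', sub_add_sub_cancel]⟩

lemma neg_self (hw : w ∈ E8) : CongTwoE8 (-w) w :=
  ⟨-w, E8_neg hw, by rw [two_smul]; abel⟩

lemma mem (h : CongTwoE8 w v) (hv : v ∈ E8) : w ∈ E8 := by
  obtain ⟨x, hx, e⟩ := h
  rw [sub_eq_iff_eq_add.mp e]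
  exact E8_add (E8_two_smul hx) hv

lemma norm_mod_four (h : CongTwoE8 w v) (hv : v ∈ E8) :
    ∃ m : ℤ, ip w w = ip v v + 4 * m := by
  obtain ⟨x, hx, e⟩ := h
  obtain ⟨a, ha⟩ := E8_norm_even hx
  obtain ⟨b, hb⟩ := E8_ip_int hx hv
  refine ⟨2 * a + b, ?_⟩
  rw [sub_eq_iff_eq_add.mp e, ip_add_self, ip_two_smul_self, ha]
  have : ip ((2 : ℚ) • x) v = 2 * b := by
    rw [← hb, ip_eq_dotProduct, smul_dotProduct, smul_eq_mul, ← ip_eq_dotProduct]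
  rw [this]
  push_cast
  ring

lemma eq_or_norm_sub_ge (h : CongTwoE8 w v) : w = v ∨ 8 ≤ ip (w - v) (w - v) := by
  obtain ⟨x, hx, e⟩ := h
  by_cases h0 : x = 0
  · left
    rw [h0, smul_zero] at e
    exact sub_eq_zero.mp e
  · right
    rw [e, ip_two_smul_self]
    linarith [E8_norm_ge_two hx h0]

lemma eq_or_eq_neg_or (h : CongTwoE8 w v) (hv : v ∈ E8) :
    w = v ∨ w = -v ∨ 8 + 2 * |ip w v| ≤ ip w w + ip v v := by
  rcases h.eq_or_norm_sub_ge with h1 | h1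
  · exact Or.inl h1
  rcases (h.trans (neg_self hv).symm).eq_or_norm_sub_ge with h2 | h2
  · exact Or.inr (Or.inl h2)
  rw [sub_neg_eq_add, ip_add_self] at h2
  rw [ip_sub_self] at h1
  refine Or.inr (Or.inr ?_)
  rcases abs_cases (ip w v) with ⟨h3, _⟩ | ⟨h3, _⟩ <;> rw [h3] <;> linarith

end CongTwoE8

lemma ncard_norm_two {v w : Fin 8 → ℚ} (hw : w ∈ E8) (hn : ip w w = 2)
    (hwv : CongTwoE8 w v) :
    {x : Fin 8 → ℚ | x ∈ E8 ∧ ip x x = 2 ∧ CongTwoE8 x v}.ncard = 2 := by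
  have : {x : Fin 8 → ℚ | x ∈ E8 ∧ ip x x = 2 ∧ CongTwoE8 x v} = {w, -w} := by
    ext x
    simp only [Set.mem_ofPred_eq, Set.mem_insert_iff, Set.mem_singleton_iff]
    constructor
    · rintro ⟨-, hxn, hxv⟩
      rcases (hxv.trans hwv.symm).eq_or_eq_neg_or hw with h | h | h
      · exact Or.inl h
      · exact Or.inr h
      · linarith [abs_nonneg (ip x w)]
    · rintro (rfl | rfl)
      · exact ⟨hw, hn, hwv⟩
      · exact ⟨E8_neg hw, by rw [ip_neg_self, hn], (CongTwoE8.neg_self hw).trans hwv⟩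
  rw [this]
  refine Set.ncard_pair fun h => ?_
  rw [self_eq_neg.mp h] at hn
  simp [ip] at hn

/-- An orthogonal frame of eight norm-4 vectors in the class of `v` modulo `2Λ`. -/
structure IsFrame (v : Fin 8 → ℚ) (f : Fin 8 → Fin 8 → ℚ) : Prop where
  cong : ∀ i, CongTwoE8 (f i) v
  ip_eq : ∀ i j, ip (f i) (f j) = if i = j then 4 else 0

lemma eq_zero_of_ip_frame {v : Fin 8 → ℚ} {f : Fin 8 → Fin 8 → ℚ} (hf : IsFrame v f)
    {w : Fin 8 → ℚ} (hw : ∀ i, ip w (f i) = 0) : w = 0 := by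
  have h1 : Matrix.of f * ((1 / 4 : ℚ) • (Matrix.of f).transpose) = 1 := by
    ext i j
    have := hf.ip_eq i j
    rw [Matrix.mul_smul, Matrix.smul_apply, Matrix.mul_apply', Matrix.one_apply]
    change (1 / 4 : ℚ) • ip (f i) (f j) = _
    rw [this]
    split_ifs <;> norm_num
  have h2 : Matrix.mulVec (Matrix.of f) w = 0 := by
    ext i
    have := hw i
    rw [ip_eq_dotProduct, dotProduct_comm] at this
    exact this
  rw [← Matrix.one_mulVec w, ← mul_eq_one_comm.mp h1, ← Matrix.mulVec_mulVec, h2,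
    Matrix.mulVec_zero]

lemma ncard_norm_four {v : Fin 8 → ℚ} (hv : v ∈ E8) {f : Fin 8 → Fin 8 → ℚ}
    (hf : IsFrame v f) :
    {x : Fin 8 → ℚ | x ∈ E8 ∧ ip x x = 4 ∧ CongTwoE8 x v}.ncard = 16 := by
  have hmem i : f i ∈ E8 := (hf.cong i).mem hv
  have hn i : ip (f i) (f i) = 4 := by simp [hf.ip_eq]
  let g : Fin 8 × Bool → Fin 8 → ℚ := fun p => if p.2 then f p.1 else -f p.1
  have hg : Function.Injective g := by
    rintro ⟨i, b⟩ ⟨j, c⟩ h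
    have h' : ip (g (i, b)) (f i) = ip (g (j, c)) (f i) := by rw [h]
    by_cases hij : i = j
    · subst hij
      cases b <;> cases c <;> simp [g, ip_eq_dotProduct] at h' ⊢ <;>
        simp only [← ip_eq_dotProduct, hn] at h' <;> norm_num at h'
    · have hji : j ≠ i := fun h => hij h.symm
      have h4 := hf.ip_eq j i
      rw [if_neg hji] at h4
      cases b <;> cases c <;> simp [g, ip_eq_dotProduct] at h' <;>
        simp only [← ip_eq_dotProduct, hn, h4] at h' <;> norm_num at h'
  have : {x : Fin 8 → ℚ | x ∈ E8 ∧ ip x x = 4 ∧ CongTwoE8 x v} = Set.range g := by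
    ext x
    simp only [Set.mem_ofPred_eq, Set.mem_range]
    constructor
    · rintro ⟨-, hxn, hxv⟩
      by_contra! hne
      have h0 : x = 0 := eq_zero_of_ip_frame hf fun i => by
        rcases (hxv.trans (hf.cong i).symm).eq_or_eq_neg_or (hmem i) with h | h | h
        · exact absurd h.symm (hne (i, true))
        · exact absurd h.symm (hne (i, false))
        · rw [hxn, hn] at h
          exact abs_eq_zero.mp (le_antisymm (by linarith) (abs_nonneg _))
      rw [h0] at hxn
      simp [ip] at hxn
    · rintro ⟨⟨i, _ | _⟩, rfl⟩
      · exact ⟨E8_neg (hmem i), (ip_neg_self _).trans (hn i),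
          (CongTwoE8.neg_self (hmem i)).trans (hf.cong i)⟩
      · exact ⟨hmem i, hn i, hf.cong i⟩
  rw [this, ← Set.image_univ, Set.ncard_image_of_injective _ hg, Set.ncard_univ]
  simp

lemma congTwoE8_of_int {v w : Fin 8 → ℚ} (k : Fin 8 → ℤ) (hk : ∀ i, w i - v i = 2 * k i)
    (hs : Even (∑ i, k i)) : CongTwoE8 w v :=
  ⟨fun i => k i, mem_E8_of_int k (fun _ => rfl) hs, funext hk⟩

/-- The class of `v` modulo `2Λ` is zero, or contains a root, or contains a frame. -/
def HasShort (v : Fin 8 → ℚ) : Prop :=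
  CongTwoE8 v 0 ∨ (∃ w, ip w w = 2 ∧ CongTwoE8 w v) ∨ ∃ f, IsFrame v f

lemma HasShort.of_cong {v w : Fin 8 → ℚ} (h : CongTwoE8 w v) (hw : HasShort w) :
    HasShort v := by
  rcases hw with h0 | ⟨x, hx, hxw⟩ | ⟨f, hf⟩
  · exact Or.inl (h.symm.trans h0)
  · exact Or.inr (Or.inl ⟨x, hx, hxw.trans h⟩)
  · exact Or.inr (Or.inr ⟨f, fun i => (hf.cong i).trans h, hf.ip_eq⟩)

lemma ip_sub_single (a b : Fin 8 → ℚ) (s t : ℚ) (i j : Fin 8) :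
    ip (a - Pi.single i s) (b - Pi.single j t) =
      ip a b - a j * t - s * b i + if i = j then s * t else 0 := by
  simp only [ip_eq_dotProduct, sub_dotProduct, dotProduct_sub, dotProduct_single,
    single_dotProduct, Pi.sub_apply, Pi.single_apply, eq_comm (a := j)]
  split_ifs <;> ring

lemma hasShort_half {v : Fin 8 → ℚ} (h : ∀ i, ∃ n : ℤ, v i = n + 1 / 2) : HasShort v := by
  have hsign : ∀ i, ∃ e k : ℤ, e * e = 1 ∧ v i = e / 2 + 2 * k := fun i => by
    obtain ⟨n, hn⟩ := h i
    rcases Int.even_or_odd n with ⟨k, hk⟩ | ⟨k, hk⟩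
    · exact ⟨1, k, rfl, by rw [hn, hk]; push_cast; ring⟩
    · exact ⟨-1, k + 1, rfl, by rw [hn, hk]; push_cast; ring⟩
  choose e k he hv using hsign
  have he' i : (e i : ℚ) * e i = 1 := by exact_mod_cast he i
  let a : Fin 8 → ℚ := fun i => e i / 2
  have haa : ip a a = 2 := by
    have : ∀ i, a i * a i = 1 / 4 := fun i => by
      simp only [a]
      linarith [he' i]
    simp only [ip, this]
    simp
    norm_num
  rcases Int.even_or_odd (∑ i, k i) with hk | hk
  · exact Or.inr (Or.inl ⟨a, haa, (congTwoE8_of_int k (fun i => by rw [hv]; ring) hk).symm⟩)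
  · refine Or.inr (Or.inr ⟨fun i => a - Pi.single i (2 * e i : ℚ), fun i => ?_, fun i j => ?_⟩)
    · refine (congTwoE8_of_int (k + Pi.single i (e i)) (fun j => ?_) ?_).symm
      · simp only [hv, a, Pi.sub_apply, Pi.add_apply, Pi.single_apply]
        split_ifs <;> push_cast <;> ring
      · simp only [Pi.add_apply, Finset.sum_add_distrib, Finset.sum_pi_single', Finset.mem_univ,
          if_true]
        refine hk.add_odd ?_
        exact (Int.odd_mul.mp (he i ▸ odd_one)).1
    · rw [ip_sub_single, haa]
      simp only [a]
      split_ifs with hij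
      · subst hij
        linarith [he' i]
      · linarith [he' i, he' j]

lemma odd_add_one_iff (n : ℤ) : Odd (n + 1) ↔ ¬ Odd n := by
  rw [Int.not_odd_iff_even, Int.odd_add]
  simp

/-- An integral vector agrees modulo 2 with a vector with entries in `{-1, 0, 1}`, and the parity
of the quotient may be prescribed unless all entries are even. -/
lemma exists_signs (n : Fin 8 → ℤ) (ho : ∃ i, Odd (n i)) (p : ℤ) :
    ∃ e k : Fin 8 → ℤ, (∀ i, e i * e i = if Odd (n i) then 1 else 0) ∧
      (∀ i, n i = e i + 2 * k i) ∧ Even (∑ i, k i - p) := by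
  have hbase : ∀ i, ∃ e k : ℤ, (e = if Odd (n i) then 1 else 0) ∧ n i = e + 2 * k := fun i => by
    rcases Int.even_or_odd (n i) with h | h
    · rw [if_neg (Int.not_odd_iff_even.mpr h)]
      obtain ⟨k, hk⟩ := h
      exact ⟨0, k, rfl, by omega⟩
    · rw [if_pos h]
      obtain ⟨k, hk⟩ := h
      exact ⟨1, k, rfl, by omega⟩
  choose e k he hn using hbase
  obtain ⟨i₀, hi₀⟩ := ho
  rcases Int.even_or_odd (∑ i, k i - p) with h | h
  · refine ⟨e, k, fun i => ?_, hn, h⟩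
    rw [he]
    split_ifs <;> rfl
  · refine ⟨e - Pi.single i₀ 2, k + Pi.single i₀ 1, fun i => ?_, fun i => ?_, ?_⟩
    · by_cases hi : i = i₀
      · subst hi
        simp [he, hi₀]
      · simp only [Pi.sub_apply, Pi.single_eq_of_ne hi, he]
        split_ifs <;> rfl
    · rw [hn i]
      simp only [Pi.sub_apply, Pi.add_apply, Pi.single_apply]
      split_ifs <;> ring
    · simp only [Pi.add_apply, Finset.sum_add_distrib, Finset.sum_pi_single', Finset.mem_univ,
        if_true]
      rw [add_sub_right_comm]
      exact h.add_odd odd_one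

lemma ip_signs {n e : Fin 8 → ℤ} (he : ∀ i, e i * e i = if Odd (n i) then 1 else 0) :
    ip (fun i => e i) (fun i => e i) = (Finset.univ.filter fun i => Odd (n i)).card := by
  have : ∀ i, (e i : ℚ) * e i = if Odd (n i) then 1 else 0 := fun i => by
    exact_mod_cast he i
  simp only [ip, this, Finset.sum_boole]

lemma congTwoE8_add_one (v : Fin 8 → ℚ) : CongTwoE8 (v + 1) v := by
  refine ⟨fun _ => 1 / 2, ⟨Or.inr fun i => ⟨0, by norm_num⟩, 2, by simp; norm_num⟩, ?_⟩
  ext i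
  simp

lemma congTwoE8_sub_single {n e k : Fin 8 → ℤ} (hn : ∀ i, n i = e i + 2 * k i)
    (hk : Odd (∑ i, k i)) {i : Fin 8} (hi : Odd (e i)) :
    CongTwoE8 ((fun j => (e j : ℚ)) - Pi.single i (2 * e i : ℚ)) (fun j => n j) := by
  refine (congTwoE8_of_int (k + Pi.single i (e i)) (fun j => ?_) ?_).symm
  · simp only [hn, Pi.sub_apply, Pi.add_apply, Pi.single_apply]
    split_ifs <;> push_cast <;> ring
  · simp only [Pi.add_apply, Finset.sum_add_distrib, Finset.sum_pi_single', Finset.mem_univ,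
      if_true]
    exact hk.add_odd hi

lemma hasShort_int_four (n : Fin 8 → ℤ)
    (hc : (Finset.univ.filter fun i => Odd (n i)).card = 4) : HasShort fun i => n i := by
  have hsplit : (Finset.univ.filter fun i => Odd (n i)).card +
      (Finset.univ.filter fun i => ¬ Odd (n i)).card = 8 := by
    rw [Finset.card_filter_add_card_filter_not]
    simp
  have hpar i : Odd (n i + 1) ↔ ¬ Odd (n i) := by
    rw [odd_add_one_iff]
  have hc' : (Finset.univ.filter fun i => Odd (n i + 1)).card = 4 := by
    simp only [hpar]
    omega
  have hne : ∃ i, Odd (n i) := by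
    obtain ⟨i, hi⟩ := Finset.card_pos.mp (by omega :
      0 < (Finset.univ.filter fun i => Odd (n i)).card)
    exact ⟨i, (Finset.mem_filter.mp hi).2⟩
  have hne' : ∃ i, Odd (n i + 1) := by
    obtain ⟨i, hi⟩ := Finset.card_pos.mp (by omega :
      0 < (Finset.univ.filter fun i => Odd (n i + 1)).card)
    exact ⟨i, (Finset.mem_filter.mp hi).2⟩
  obtain ⟨a, k, ha, hk, hks⟩ := exists_signs n hne 1
  obtain ⟨b, l, hb, hl, hls⟩ := exists_signs (fun i => n i + 1) hne' 1
  replace hks : Odd (∑ i, k i) := by simpa using hks.add_odd odd_one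
  replace hls : Odd (∑ i, l i) := by simpa using hls.add_odd odd_one
  have haa := ip_signs ha
  have hbb := ip_signs (n := fun i => n i + 1) hb
  rw [hc] at haa
  rw [hc'] at hbb
  have ha1 i (h : Odd (n i)) : a i * a i = 1 ∧ b i = 0 := by
    refine ⟨by simpa [h] using ha i, ?_⟩
    simpa [hpar, h] using hb i
  have hb1 i (h : ¬ Odd (n i)) : b i * b i = 1 ∧ a i = 0 := by
    refine ⟨by simpa [hpar, h] using hb i, ?_⟩
    simpa [h] using ha i
  have hab : ip (fun i => a i) (fun i => b i) = 0 := by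
    refine Finset.sum_eq_zero fun i _ => ?_
    by_cases h : Odd (n i)
    · simp [(ha1 i h).2]
    · simp [(hb1 i h).2]
  have hba : ip (fun i => b i) (fun i => a i) = 0 := by
    rw [ip_eq_dotProduct, dotProduct_comm, ← ip_eq_dotProduct, hab]
  refine Or.inr (Or.inr ⟨fun i => if Odd (n i) then
    (fun j => (a j : ℚ)) - Pi.single i (2 * a i : ℚ) else
    (fun j => (b j : ℚ)) - Pi.single i (2 * b i : ℚ), fun i => ?_, fun i j => ?_⟩)
  · split_ifs with h
    · exact congTwoE8_sub_single hk hks (Int.odd_mul.mp ((ha1 i h).1 ▸ odd_one)).1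
    · refine (congTwoE8_sub_single hl hls (Int.odd_mul.mp ((hb1 i h).1 ▸ odd_one)).1).trans ?_
      convert congTwoE8_add_one (fun j => (n j : ℚ)) using 1
      ext j
      simp
  · have hq i (h : Odd (n i)) : (a i : ℚ) * a i = 1 ∧ (b i : ℚ) = 0 := by
      exact_mod_cast ha1 i h
    have hq' i (h : ¬ Odd (n i)) : (b i : ℚ) * b i = 1 ∧ (a i : ℚ) = 0 := by
      exact_mod_cast hb1 i h
    by_cases hij : i = j
    · subst hij
      by_cases hi : Odd (n i)
      · simp only [if_pos hi, ip_sub_single, haa, if_true]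
        push_cast
        linarith [(hq i hi).1]
      · simp only [if_neg hi, ip_sub_single, hbb, if_true]
        push_cast
        linarith [(hq' i hi).1]
    · by_cases hi : Odd (n i) <;> by_cases hj : Odd (n j) <;>
        simp only [hi, hj, if_true, if_false, ip_sub_single, haa, hbb, hab, hba, hij]
      · push_cast
        linarith [(hq i hi).1, (hq j hj).1]
      · rw [(hq i hi).2, (hq' j hj).2]
        ring
      · rw [(hq' i hi).2, (hq j hj).2]
        ring
      · push_cast
        linarith [(hq' i hi).1, (hq' j hj).1]

lemma hasShort_int_two (n : Fin 8 → ℤ)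
    (hc : (Finset.univ.filter fun i => Odd (n i)).card = 2) : HasShort fun i => n i := by
  obtain ⟨i, hi⟩ := Finset.card_pos.mp (by omega :
    0 < (Finset.univ.filter fun i => Odd (n i)).card)
  obtain ⟨a, k, ha, hk, hks⟩ := exists_signs n ⟨i, (Finset.mem_filter.mp hi).2⟩ 0
  rw [sub_zero] at hks
  refine Or.inr (Or.inl ⟨fun i => a i, by rw [ip_signs ha, hc]; rfl,
    (congTwoE8_of_int k (fun i => ?_) hks).symm⟩)
  rw [hk]
  push_cast
  ring

lemma hasShort_int_zero (n : Fin 8 → ℤ)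
    (hc : (Finset.univ.filter fun i => Odd (n i)).card = 0) : HasShort fun i => n i := by
  have hev : ∀ i, ∃ k, n i = 2 * k := fun i => by
    have := Finset.filter_eq_empty_iff.mp (Finset.card_eq_zero.mp hc) (Finset.mem_univ i)
    exact (Int.not_odd_iff_even.mp this).two_dvd
  choose k hk using hev
  rcases Int.even_or_odd (∑ i, k i) with h | h
  · exact Or.inl (congTwoE8_of_int k (fun i => by simp [hk]) h)
  · refine Or.inr (Or.inr ⟨fun i => Pi.single i 2, fun i => ?_, fun i j => ?_⟩)
    · refine (congTwoE8_of_int (k - Pi.single i 1) (fun j => ?_) ?_).symm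
      · simp only [hk, Pi.sub_apply, Pi.single_apply]
        split_ifs <;> push_cast <;> ring
      · simp only [Pi.sub_apply, Finset.sum_sub_distrib, Finset.sum_pi_single', Finset.mem_univ,
          if_true]
        exact h.sub_odd odd_one
    · rw [ip_eq_dotProduct, single_dotProduct, Pi.single_apply]
      split_ifs <;> norm_num

lemma hasShort_int_of_card_le (n : Fin 8 → ℤ) (hs : Even (∑ i, n i))
    (hc : (Finset.univ.filter fun i => Odd (n i)).card ≤ 4) : HasShort fun i => n i := by
  have hev : Even (Finset.univ.filter fun i => Odd (n i)).card := by
    have hpar : Even (∑ i, ((n i) - if Odd (n i) then 1 else 0)) :=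
      Finset.even_sum _ fun i _ => by
        split_ifs with h
        · exact h.sub_odd odd_one
        · simpa using h
    rw [Finset.sum_sub_distrib, Finset.sum_boole, Int.even_sub] at hpar
    exact_mod_cast hpar.mp hs
  generalize hm : (Finset.univ.filter fun i => Odd (n i)).card = m at hc hev
  interval_cases m
  · exact hasShort_int_zero n hm
  · exact absurd hev (by decide)
  · exact hasShort_int_two n hm
  · exact absurd hev (by decide)
  · exact hasShort_int_four n hm

lemma hasShort_int (n : Fin 8 → ℤ) (hs : Even (∑ i, n i)) : HasShort fun i => n i := by
  by_cases hc : (Finset.univ.filter fun i => Odd (n i)).card ≤ 4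
  · exact hasShort_int_of_card_le n hs hc
  · have hsplit : (Finset.univ.filter fun i => Odd (n i)).card +
        (Finset.univ.filter fun i => ¬ Odd (n i)).card = 8 := by
      rw [Finset.card_filter_add_card_filter_not]
      simp
    refine HasShort.of_cong ?_ (hasShort_int_of_card_le (fun i => n i + 1) ?_ ?_)
    · convert congTwoE8_add_one (fun j => (n j : ℚ)) using 1
      ext j
      simp
    · rw [Finset.sum_add_distrib]
      exact hs.add (by simp; decide)
    · simp only [odd_add_one_iff]
      omega

lemma hasShort_of_mem {v : Fin 8 → ℚ} (hv : v ∈ E8) : HasShort v := by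
  obtain ⟨h | h, m, hm⟩ := hv
  · choose n hn using h
    obtain rfl : v = fun i => (n i : ℚ) := funext hn
    refine hasShort_int n ⟨m, ?_⟩
    rw [← two_mul]
    have hm' : (∑ i, (n i : ℚ)) = 2 * m := hm
    exact_mod_cast hm'
  · exact hasShort_half h

/-- Every nonzero isotropic point of `E₈/2E₈` (the class of a lattice vector `v ∉ 2Λ`
with `⟨v,v⟩/2` even) is the image of exactly 16 norm-4 vectors of `E₈`, namely ±8 pairs;
and every nonzero anisotropic point (`⟨v,v⟩/2` odd) is the image of exactly 2 norm-2
vectors. -/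
theorem stmt10 :
    (∀ v ∈ E8, ¬(∃ u ∈ E8, v = (2 : ℚ) • u) → (∃ m : ℤ, ip v v / 2 = 2 * m) →
      {w : Fin 8 → ℚ | w ∈ E8 ∧ ip w w = 4 ∧ ∃ u ∈ E8, w - v = (2 : ℚ) • u}.ncard = 16 ∧
      ∀ w, (w ∈ E8 ∧ ip w w = 4 ∧ ∃ u ∈ E8, w - v = (2 : ℚ) • u) →
        (-w ∈ E8 ∧ ip (-w) (-w) = 4 ∧ ∃ u ∈ E8, -w - v = (2 : ℚ) • u)) ∧
    (∀ v ∈ E8, ¬(∃ u ∈ E8, v = (2 : ℚ) • u) → (∃ m : ℤ, ip v v / 2 = 2 * m + 1) →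
      {w : Fin 8 → ℚ | w ∈ E8 ∧ ip w w = 2 ∧ ∃ u ∈ E8, w - v = (2 : ℚ) • u}.ncard = 2) := by
  refine ⟨fun v hv h0 ⟨m, hm⟩ => ⟨?_, ?_⟩, fun v hv h0 ⟨m, hm⟩ => ?_⟩
  · rcases hasShort_of_mem hv with ⟨u, hu, e⟩ | ⟨w, hw, hwv⟩ | ⟨f, hf⟩
    · exact absurd ⟨u, hu, by rwa [sub_zero] at e⟩ h0
    · obtain ⟨c, hc⟩ := hwv.norm_mod_four hv
      have : (1 : ℚ) = 2 * m + 2 * c := by linarith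
      have : (1 : ℤ) = 2 * m + 2 * c := by exact_mod_cast this
      omega
    · exact ncard_norm_four hv hf
  · rintro w ⟨hw, hn, hwv⟩
    exact ⟨E8_neg hw, by rw [ip_neg_self, hn], (CongTwoE8.neg_self hw).trans hwv⟩
  · rcases hasShort_of_mem hv with ⟨u, hu, e⟩ | ⟨w, hw, hwv⟩ | ⟨f, hf⟩
    · exact absurd ⟨u, hu, by rwa [sub_zero] at e⟩ h0
    · exact ncard_norm_two (hwv.mem hv) hw hwv
    · obtain ⟨c, hc⟩ := (hf.cong 0).norm_mod_four hv
      rw [hf.ip_eq, if_pos rfl] at hc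
      have : (2 : ℚ) = 2 * m + 1 + 2 * c := by linarith
      have : (2 : ℤ) = 2 * m + 1 + 2 * c := by exact_mod_cast this
      omega
end
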